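/- Let m ≥ 6 with m ≡ 2 (mod 4), and let e be an integer with 2 ≤ e ≤ m/2 and gcd(m,e) = 2. Then for every 2-element subset {x,y} of F = GF(2^m), the number of 8-element subsets B of F with {x,y} ⊆ B, ∑_{g∈B} g = 0 and ∑_{g∈B} g^{2^e+1} = 0 equals (2^m−4)(2^{3m} − 23·2^{2m} + 344·2^m − 1612)/720. In other words, these 8-element subsets form a 2-(2^m, 8, λ) design on the point set F with this λ. -/

import Mathlib

open Finset

section SubsetSums

variable {ι G : Type*} [Fintype ι] [DecidableEq ι] [AddCommGroup G] [DecidableEq G]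

/-- The number of `k`-element index sets over which `h` sums to `s`. -/
def subsetSumCount (h : ι → G) (k : ℕ) (s : G) : ℕ :=
  #{B ∈ powersetCard k (univ : Finset ι) | ∑ i ∈ B, h i = s}

theorem card_filter_notMem_eq (h : ι → G) (k : ℕ) (t : G) (i : ι) :
    #{B ∈ powersetCard k (univ : Finset ι) | ∑ j ∈ B, h j = t ∧ i ∉ B} =
      #{B ∈ powersetCard (k + 1) (univ : Finset ι) | ∑ j ∈ B, h j = t + h i ∧ i ∈ B} := by
  refine card_bij' (fun B _ => insert i B) (fun B _ => B.erase i) ?_ ?_ ?_ ?_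
  · intro B hB
    simp only [mem_filter, mem_powersetCard_univ] at hB ⊢
    obtain ⟨h1, h2, h3⟩ := hB
    refine ⟨by rw [card_insert_of_notMem h3, h1], ?_, mem_insert_self _ _⟩
    rw [sum_insert h3, h2, add_comm]
  · intro B hB
    simp only [mem_filter, mem_powersetCard_univ] at hB ⊢
    obtain ⟨h1, h2, h3⟩ := hB
    refine ⟨by rw [card_erase_of_mem h3, h1]; rfl, ?_, notMem_erase _ _⟩
    rw [← sum_erase_add _ _ h3] at h2
    exact add_right_cancel h2
  · intro B hB
    simp only [mem_filter] at hB
    exact erase_insert hB.2.2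
  · intro B hB
    simp only [mem_filter] at hB
    exact insert_erase hB.2.2

theorem sum_card_filter_mem_eq (h : ι → G) (k : ℕ) (s : G) :
    ∑ i, #{B ∈ powersetCard k (univ : Finset ι) | ∑ j ∈ B, h j = s ∧ i ∈ B} =
      k * subsetSumCount h k s := by
  have := sum_card_bipartiteAbove_eq_sum_card_bipartiteBelow
    (s := (univ : Finset ι)) (t := {B ∈ powersetCard k (univ : Finset ι) | ∑ j ∈ B, h j = s})
    (fun i B => i ∈ B)
  simp only [bipartiteAbove, bipartiteBelow, filter_filter, filter_univ_mem] at this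
  rw [this, sum_congr rfl (g := fun _ => k), sum_const, subsetSumCount, smul_eq_mul, mul_comm]
  intro B hB
  simp only [mem_filter, mem_powersetCard_univ] at hB
  exact hB.1

theorem sum_card_filter_notMem_add (h : ι → G) (k : ℕ) (s : G) :
    ∑ i, #{B ∈ powersetCard k (univ : Finset ι) | ∑ j ∈ B, h j = s ∧ i ∉ B} +
      k * subsetSumCount h k s = Fintype.card ι * subsetSumCount h k s := by
  rw [← sum_card_filter_mem_eq, ← sum_add_distrib]
  simp only [← filter_filter]
  simp_rw [add_comm, card_filter_add_card_filter_not]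
  rw [sum_const, subsetSumCount, card_univ, smul_eq_mul]

theorem sum_subsetSumCount_zero (h : ι → G) (hh : ∀ i, h i + h i = 0) (s : G) :
    ∑ i, subsetSumCount h 0 (s + h i) = subsetSumCount h 1 s := by
  rw [← one_mul (subsetSumCount h 1 s), ← sum_card_filter_mem_eq]
  refine sum_congr rfl fun i _ => ?_
  have := card_filter_notMem_eq h 0 (s + h i) i
  rw [add_assoc, hh, add_zero, zero_add] at this
  rw [← this, subsetSumCount]
  congr 1
  refine filter_congr fun B hB => ?_
  rw [powersetCard_zero, mem_singleton] at hB
  simp [hB]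

theorem sum_subsetSumCount_succ (h : ι → G) (hh : ∀ i, h i + h i = 0) (k : ℕ) (s : G) :
    ∑ i, subsetSumCount h (k + 1) (s + h i) + k * subsetSumCount h k s =
      (k + 2) * subsetSumCount h (k + 2) s + Fintype.card ι * subsetSumCount h k s := by
  rw [← sum_card_filter_notMem_add, ← sum_card_filter_mem_eq h (k + 2), ← add_assoc,
    ← sum_add_distrib]
  congr 1
  refine sum_congr rfl fun i _ => ?_
  have h1 := card_filter_notMem_eq h (k + 1) (s + h i) i
  rw [add_assoc, hh, add_zero] at h1
  rw [← h1, card_filter_notMem_eq h k s i, ← filter_filter, ← filter_filter, add_comm (#_),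
    card_filter_add_card_filter_not, subsetSumCount]

/-- The convolution operator `φ ↦ ∑ i, φ (· + h i)`. -/
def shiftSum (h : ι → G) : (G → ℚ) →ₗ[ℚ] (G → ℚ) where
  toFun φ s := ∑ i, φ (s + h i)
  map_add' φ ψ := by ext s; simp [sum_add_distrib]
  map_smul' c φ := by ext s; simp [mul_sum]

end SubsetSums

/-- Solving the three-term recurrence up to index eight when the operator satisfies a cubic
relation on the initial vector, modulo an eigenvector. -/
theorem eighth_term_of_recurrence {V : Type*} [AddCommGroup V] [Module ℚ V] (T : V →ₗ[ℚ] V)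
    (E : ℕ → V) (c : V) (q : ℚ) (h1 : E 1 = T (E 0))
    (hrec : ∀ k : ℕ, ((k : ℚ) + 2) • E (k + 2) = T (E (k + 1)) - (q - k) • E k)
    (hT : T (T (T (E 0))) = (4 * q) • T (E 0) + (q - 4) • c) (hc : T c = q • c) :
    (40320 : ℚ) • E 8 = (-5040 * q + 4620 * q ^ 2 - 1260 * q ^ 3 + 105 * q ^ 4) • E 0 +
      (8448 - 2016 * q - 168 * q ^ 2 + 36 * q ^ 3) • T (T (E 0)) +
      (-9856 * q + 6832 * q ^ 2 - 1996 * q ^ 3 + 322 * q ^ 4 - 28 * q ^ 5 + q ^ 6) • c := by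
  have step : ∀ k : ℕ, E (k + 2) = ((k : ℚ) + 2)⁻¹ • (T (E (k + 1)) - (q - k) • E k) := by
    intro k
    rw [← hrec, smul_smul, inv_mul_cancel₀ (by positivity), one_smul]
  have h2 : E 2 = (1 / 2 : ℚ) • (T (T (E 0)) - q • E 0) := by
    rw [step 0, h1]; push_cast; module
  have h3 : E 3 = (1 / 6 : ℚ) • ((q + 2) • T (E 0) + (q - 4) • c) := by
    rw [step 1, h2, h1]; simp only [map_smul, map_sub, hT]; push_cast; module
  have h4 : E 4 = (1 / 24 : ℚ) • ((-6 * q + 3 * q ^ 2) • E 0 + (8 - 2 * q) • T (T (E 0)) +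
      (-4 * q + q ^ 2) • c) := by
    rw [step 2, h3, h2]; simp only [map_smul, map_add, hc]; push_cast; module
  have h5 : E 5 = (1 / 120 : ℚ) • ((24 + 30 * q - 9 * q ^ 2) • T (E 0) +
      (-80 + 44 * q - 10 * q ^ 2 + q ^ 3) • c) := by
    rw [step 3, h4, h3]; simp only [map_smul, map_add, hT, hc]; push_cast; module
  have h6 : E 6 = (1 / 720 : ℚ) • ((-120 * q + 90 * q ^ 2 - 15 * q ^ 3) • E 0 +
      (184 - 50 * q + q ^ 2) • T (T (E 0)) +
      (-160 * q + 84 * q ^ 2 - 15 * q ^ 3 + q ^ 4) • c) := by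
    rw [step 4, h5, h4]; simp only [map_smul, map_add, hc]; push_cast; module
  have h7 : E 7 = (1 / 5040 : ℚ) • ((720 + 1372 * q - 560 * q ^ 2 + 43 * q ^ 3) • T (E 0) +
      (-3136 + 2184 * q - 778 * q ^ 2 + 175 * q ^ 3 - 21 * q ^ 4 + q ^ 5) • c) := by
    rw [step 5, h6, h5]; simp only [map_smul, map_add, hT, hc]; push_cast; module
  rw [step 6, h7, h6]; simp only [map_smul, map_add, hc]; push_cast; module

theorem coprime_two_pow_sub_one {m e : ℕ} (hm4 : m % 4 = 2) (hgcd : Nat.gcd m e = 2) :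
    Nat.Coprime (2 ^ m - 1) (2 ^ e + 1) := by
  obtain ⟨n, rfl⟩ : 2 ∣ m := by omega
  obtain ⟨f, rfl⟩ : 2 ∣ e := hgcd ▸ Nat.gcd_dvd_right _ _
  have hnf : Nat.Coprime n f := by
    rw [Nat.gcd_mul_left] at hgcd
    exact Nat.eq_of_mul_eq_mul_left two_pos hgcd
  have hn : Nat.Coprime n (2 * f) :=
    Nat.Coprime.mul_right (Nat.coprime_two_right.2 (Nat.odd_iff.2 (by omega))) hnf
  have hdvd : 2 ^ (2 * f) + 1 ∣ 2 ^ (2 * (2 * f)) - 1 := by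
    refine ⟨2 ^ (2 * f) - 1, ?_⟩
    rw [mul_comm 2 (2 * f), pow_mul, ← Nat.sq_sub_sq, one_pow]
  have hd : Nat.gcd (2 ^ (2 * n) - 1) (2 ^ (2 * f) + 1) ∣ 3 := by
    have := Nat.gcd_dvd_gcd_of_dvd_right (2 ^ (2 * n) - 1) hdvd
    rwa [Nat.pow_sub_one_gcd_pow_sub_one, Nat.gcd_mul_left, hn.gcd_eq_one] at this
  rcases (Nat.dvd_prime Nat.prime_three).1 hd with h | h
  · exact h
  · exfalso
    have h3 : 3 ∣ 2 ^ (2 * f) + 1 := h ▸ Nat.gcd_dvd_right _ _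
    have h4 : 2 ^ (2 * f) % 3 = 1 := by
      rw [pow_mul, Nat.pow_mod]; simp
    omega

section Field

variable {F : Type*} [Field F] [Fintype F]

theorem pow_bijective_of_coprime {n : ℕ} (hn0 : n ≠ 0)
    (hn : Nat.Coprime (Fintype.card F - 1) n) : Function.Bijective fun x : F => x ^ n := by
  rw [← Finite.injective_iff_bijective]
  intro x y hxy
  simp only at hxy
  by_cases hx : x = 0
  · subst hx
    rw [zero_pow hn0] at hxy
    exact (eq_zero_of_pow_eq_zero hxy.symm).symm
  by_cases hy : y = 0
  · subst hy
    rw [zero_pow hn0] at hxy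
    exact eq_zero_of_pow_eq_zero hxy
  have hc : (Nat.card Fˣ).Coprime n := by
    classical
    rwa [Nat.card_eq_fintype_card, Fintype.card_units]
  have := (powCoprime hc).injective (a₁ := Units.mk0 x hx) (a₂ := Units.mk0 y hy)
    (by ext; simpa using hxy)
  simpa using congrArg Units.val this

theorem pow_two_pow_eq_self_iff [CharP F 2] {m e : ℕ} (hF : Fintype.card F = 2 ^ m)
    (hgcd : Nat.gcd m e = 2) (t : F) : t ^ 2 ^ e = t ↔ t ^ 4 = t := by
  have key : ∀ n : ℕ, Function.IsPeriodicPt (frobenius F 2) n t ↔ t ^ 2 ^ n = t := by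
    intro n
    rw [Function.IsPeriodicPt, Function.IsFixedPt, iterate_frobenius]
  have h4 : t ^ 4 = t ↔ Function.IsPeriodicPt (frobenius F 2) 2 t := by
    rw [key]; norm_num
  rw [h4, ← key]
  constructor
  · intro h
    have hm : Function.IsPeriodicPt (frobenius F 2) m t := by
      rw [key, ← hF, FiniteField.pow_card]
    have := hm.gcd h
    rwa [hgcd] at this
  · intro h
    exact h.trans_dvd (hgcd ▸ Nat.gcd_dvd_right _ _)

theorem card_pow_four_eq_self [DecidableEq F] (h3 : 3 ∣ Fintype.card F - 1) :
    #{t : F | t ^ 4 = t} = 4 := by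
  have : Fact (Nat.Prime 3) := ⟨Nat.prime_three⟩
  rw [← Fintype.card_units] at h3
  obtain ⟨z, hz⟩ := exists_prime_orderOf_dvd_card 3 h3
  have hz3 : (z : F) ^ 3 = 1 := by
    rw [← Units.val_pow_eq_pow_val, ← hz, pow_orderOf_eq_one, Units.val_one]
  have hz1 : (z : F) ≠ 1 := by
    intro h
    rw [Units.val_eq_one] at h
    simp [h] at hz
  have hz0 : (z : F) ≠ 0 := z.ne_zero
  generalize (z : F) = w at hz3 hz1 hz0
  have hw : w ^ 2 + w + 1 = 0 := by
    have : (w - 1) * (w ^ 2 + w + 1) = 0 := by linear_combination hz3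
    exact (mul_eq_zero.1 this).resolve_left (sub_ne_zero.2 hz1)
  have hset : ({t : F | t ^ 4 = t} : Finset F) = {0, 1, w, w ^ 2} := by
    ext t
    simp only [mem_filter, mem_univ, true_and, mem_insert, mem_singleton]
    have hfac : t ^ 4 - t = t * ((t - 1) * ((t - w) * (t - w ^ 2))) := by
      linear_combination (-t ^ 2 + t ^ 3) * hw - (t ^ 2 - t) * hz3
    rw [← sub_eq_zero, hfac, mul_eq_zero, mul_eq_zero, mul_eq_zero, sub_eq_zero, sub_eq_zero,
      sub_eq_zero]
  have hw1 : w ^ 2 ≠ 1 := fun h => hz1 (by linear_combination hz3 - w * h)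
  have hw2 : w ≠ w ^ 2 := fun h => hz1 (by
    have : w * (w - 1) = 0 := by linear_combination -h
    exact sub_eq_zero.1 ((mul_eq_zero.1 this).resolve_left hz0))
  rw [hset, card_insert_of_notMem, card_insert_of_notMem, card_insert_of_notMem, card_singleton]
  · simpa using hw2
  · simp [hz1.symm, hw1.symm]
  · simp [hz0.symm, (pow_ne_zero 2 hz0).symm]

/-- The graph of `x ↦ x ^ (2 ^ e + 1)`, giving the two syndromes of a point. -/
def goldPoint (F : Type*) [Field F] (e : ℕ) (g : F) : F × F := (g, g ^ (2 ^ e + 1))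

section GoldCounting

variable [DecidableEq F] [CharP F 2] {m e : ℕ}

theorem sum_sum_polarization_eq (hm4 : m % 4 = 2) (hgcd : Nat.gcd m e = 2)
    (hF : Fintype.card F = 2 ^ m) (w : F) :
    ∑ a : F, ∑ b : F, (if a ^ 2 ^ e * b + a * b ^ 2 ^ e = w then (1 : ℚ) else 0) =
      4 * Fintype.card F * (if w = 0 then 1 else 0) + (Fintype.card F - 4) := by
  have hbij : Function.Bijective fun x : F => x ^ (2 ^ e + 1) :=
    pow_bijective_of_coprime (Nat.succ_ne_zero _) (hF ▸ coprime_two_pow_sub_one hm4 hgcd)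
  have hscale : ∀ a : F,
      ∑ b : F, (if a ^ 2 ^ e * b + a * b ^ 2 ^ e = w then (1 : ℚ) else 0) =
        ∑ t : F, (if a ^ (2 ^ e + 1) * (t + t ^ 2 ^ e) = w then (1 : ℚ) else 0) := by
    intro a
    by_cases ha : a = 0
    · simp [ha]
    · refine (Fintype.sum_equiv (Equiv.mulLeft₀ a ha) _ _ fun t => ?_).symm
      rw [Equiv.mulLeft₀_apply, show a ^ 2 ^ e * (a * t) + a * (a * t) ^ 2 ^ e =
        a ^ (2 ^ e + 1) * (t + t ^ 2 ^ e) by rw [mul_pow]; ring]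
  have hinner : ∀ t : F,
      ∑ a : F, (if a ^ (2 ^ e + 1) * (t + t ^ 2 ^ e) = w then (1 : ℚ) else 0) =
        1 + (if t ^ 4 = t then (Fintype.card F * (if w = 0 then 1 else 0) - 1 : ℚ) else 0) := by
    intro t
    rw [hbij.sum_comp fun z => if z * (t + t ^ 2 ^ e) = w then (1 : ℚ) else 0]
    have ht : t + t ^ 2 ^ e = 0 ↔ t ^ 4 = t := by
      rw [CharTwo.add_eq_zero, eq_comm, pow_two_pow_eq_self_iff hF hgcd]
    by_cases h4 : t ^ 4 = t
    · rw [ht.2 h4, if_pos h4]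
      by_cases hw : w = 0 <;> simp [hw, eq_comm]
    · have hne : t + t ^ 2 ^ e ≠ 0 := fun h => h4 (ht.1 h)
      simp [h4, ← eq_div_iff hne]
  have h3 : 3 ∣ Fintype.card F - 1 := by
    have := Nat.pow_sub_one_gcd_pow_sub_one 2 2 m
    have h2m : Nat.gcd 2 m = 2 := Nat.gcd_eq_left (by omega)
    rw [h2m] at this
    rw [hF]
    exact (show 3 = 2 ^ 2 - 1 by norm_num) ▸ Nat.gcd_eq_left_iff_dvd.1 this
  simp_rw [hscale]
  rw [sum_comm]
  simp_rw [hinner]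
  rw [sum_add_distrib, ← sum_filter, sum_const, sum_const, card_pow_four_eq_self h3, card_univ]
  simp only [nsmul_eq_mul]
  push_cast
  ring

theorem shiftSum_goldPoint_indicator (s : F × F) :
    shiftSum (goldPoint F e) (fun s => if s = 0 then 1 else 0) s =
      if s.1 ^ (2 ^ e + 1) = s.2 then 1 else 0 := by
  obtain ⟨u, v⟩ := s
  simp only [shiftSum, LinearMap.coe_mk, AddHom.coe_mk, goldPoint, Prod.mk_add_mk,
    Prod.mk_eq_zero, CharTwo.add_eq_zero, ite_and]
  simp [eq_comm]

theorem shiftSum_cube_indicator (hm4 : m % 4 = 2) (hgcd : Nat.gcd m e = 2)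
    (hF : Fintype.card F = 2 ^ m) :
    let T := shiftSum (goldPoint F e)
    let δ : F × F → ℚ := fun s => if s = 0 then 1 else 0
    T (T (T δ)) = (4 * Fintype.card F : ℚ) • T δ + (Fintype.card F - 4 : ℚ) • fun _ => 1 := by
  intro T δ
  have hTδ : T δ = fun s => if s.1 ^ (2 ^ e + 1) = s.2 then 1 else 0 :=
    funext shiftSum_goldPoint_indicator
  rw [hTδ]
  ext ⟨u, v⟩
  simp only [T, shiftSum, LinearMap.coe_mk, AddHom.coe_mk, goldPoint, Prod.mk_add_mk,
    Pi.add_apply, Pi.smul_apply, smul_eq_mul, mul_one]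
  rw [← Equiv.sum_comp (Equiv.addRight u)]
  have key := sum_sum_polarization_eq hm4 hgcd hF (u ^ (2 ^ e + 1) + v)
  simp only [CharTwo.add_eq_zero] at key
  rw [← key]
  refine sum_congr rfl fun a _ => ?_
  rw [← Equiv.sum_comp (Equiv.addRight u)]
  refine sum_congr rfl fun b _ => ?_
  have h2 : (2 : F) = 0 := CharTwo.two_eq_zero
  simp only [Equiv.coe_addRight]
  refine if_congr ?_ rfl rfl
  rw [show u + (a + u) + (b + u) = a + b + u by linear_combination u * h2]
  simp only [pow_succ, add_pow_char_pow]
  rw [← sub_eq_zero, ← sub_eq_zero (a := a ^ 2 ^ e * b + _)]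
  generalize a ^ 2 ^ e = a', b ^ 2 ^ e = b', u ^ 2 ^ e = u'
  refine Eq.congr ?_ rfl
  ring

theorem shiftSum_sq_indicator_zero :
    shiftSum (goldPoint F e) (shiftSum (goldPoint F e) fun s => if s = 0 then 1 else 0) 0 =
      Fintype.card F := by
  rw [show shiftSum (goldPoint F e) (fun s => if s = 0 then 1 else 0) = _ from
    funext shiftSum_goldPoint_indicator]
  simp [shiftSum, goldPoint]

theorem subsetSumCount_goldPoint_eight (hm4 : m % 4 = 2) (hgcd : Nat.gcd m e = 2)
    (hF : Fintype.card F = 2 ^ m) :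
    (40320 : ℚ) * subsetSumCount (goldPoint F e) 8 0 =
      Fintype.card F * (Fintype.card F - 1) * ((Fintype.card F - 4) *
        ((Fintype.card F : ℚ) ^ 3 - 23 * (Fintype.card F : ℚ) ^ 2 +
          344 * Fintype.card F - 1612)) := by
  have hh : ∀ g : F, goldPoint F e g + goldPoint F e g = 0 := by
    intro g
    simp [goldPoint, CharTwo.add_self_eq_zero]
  let E : ℕ → F × F → ℚ := fun k s => subsetSumCount (goldPoint F e) k s
  have hE0 : E 0 = fun s => if s = 0 then 1 else 0 := by
    ext s
    by_cases hs : s = 0 <;>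
      simp [E, subsetSumCount, filter_singleton, hs, eq_comm]
  have h8 := eighth_term_of_recurrence (shiftSum (goldPoint F e)) E (fun _ => 1)
    (Fintype.card F) ?_ ?_ (hE0 ▸ shiftSum_cube_indicator hm4 hgcd hF) ?_
  · have h8 := congrFun h8 0
    simp only [Pi.add_apply, Pi.smul_apply, hE0, smul_eq_mul, shiftSum_sq_indicator_zero,
      if_true] at h8
    linear_combination h8
  · ext s
    simp only [E, shiftSum, LinearMap.coe_mk, AddHom.coe_mk]
    exact_mod_cast (sum_subsetSumCount_zero _ hh s).symm
  · intro k
    ext s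
    have := sum_subsetSumCount_succ _ hh k s
    simp only [E, shiftSum, LinearMap.coe_mk, AddHom.coe_mk, Pi.smul_apply, Pi.sub_apply,
      smul_eq_mul]
    have := congrArg (Nat.cast : ℕ → ℚ) this
    push_cast at this
    linear_combination -this
  · ext s
    simp [shiftSum]

end GoldCounting

section Design

variable [DecidableEq F]

/-- The eight-element sets with both power sums zero. -/
def weightEightBlocks (F : Type*) [Field F] [Fintype F] [DecidableEq F] (e : ℕ) :
    Finset (Finset F) :=
  {B ∈ powersetCard 8 (univ : Finset F) | ∑ g ∈ B, g = 0 ∧ ∑ g ∈ B, g ^ (2 ^ e + 1) = 0}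

theorem mem_weightEightBlocks {e : ℕ} {B : Finset F} : B ∈ weightEightBlocks F e ↔
    #B = 8 ∧ ∑ g ∈ B, g = 0 ∧ ∑ g ∈ B, g ^ (2 ^ e + 1) = 0 := by
  simp [weightEightBlocks]

theorem card_weightEightBlocks (e : ℕ) :
    #(weightEightBlocks F e) = subsetSumCount (goldPoint F e) 8 0 := by
  simp only [weightEightBlocks, subsetSumCount, goldPoint, Prod.ext_iff, Prod.fst_sum,
    Prod.snd_sum, Prod.fst_zero, Prod.snd_zero]

theorem map_affine_mem_weightEightBlocks [CharP F 2] {e : ℕ} {B : Finset F}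
    (hB : B ∈ weightEightBlocks F e) {c : F} (d : F) (φ : F ↪ F) (hφ : ∀ g, φ g = c * g + d) :
    B.map φ ∈ weightEightBlocks F e := by
  rw [mem_weightEightBlocks] at hB ⊢
  obtain ⟨h8, h1, h2⟩ := hB
  have hs : ∑ g ∈ B, g ^ 2 ^ e = 0 := by
    rw [← sum_pow_char_pow, h1, zero_pow (by positivity)]
  have h80 : ((8 : ℕ) : F) = 0 := by
    rw [CharP.cast_eq_zero_iff F 2]; norm_num
  refine ⟨by rw [card_map, h8], ?_, ?_⟩
  · rw [sum_map]
    simp only [hφ]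
    rw [sum_add_distrib, ← mul_sum, h1, sum_const, h8, nsmul_eq_mul, h80, zero_mul, mul_zero,
      add_zero]
  · rw [sum_map]
    simp only [hφ]
    have hexp : ∀ g : F, (c * g + d) ^ (2 ^ e + 1) = c ^ (2 ^ e + 1) * g ^ (2 ^ e + 1) +
        c ^ 2 ^ e * d * g ^ 2 ^ e + d ^ 2 ^ e * c * g + d ^ (2 ^ e + 1) := by
      intro g
      rw [pow_succ, add_pow_char_pow, mul_pow]
      ring
    simp only [hexp]
    rw [sum_add_distrib, sum_add_distrib, sum_add_distrib, ← mul_sum, ← mul_sum, ← mul_sum,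
      h1, h2, hs, sum_const, h8, nsmul_eq_mul, h80]
    ring

theorem card_blocks_through_pair_le [CharP F 2] (e : ℕ) {x y x' y' : F} (h : x ≠ y)
    (h' : x' ≠ y') :
    #{B ∈ weightEightBlocks F e | x ∈ B ∧ y ∈ B} ≤
      #{B ∈ weightEightBlocks F e | x' ∈ B ∧ y' ∈ B} := by
  have hyx : y - x ≠ 0 := sub_ne_zero.2 h.symm
  have hc : (y' - x') / (y - x) ≠ 0 := div_ne_zero (sub_ne_zero.2 h'.symm) hyx
  obtain ⟨c, hcdef⟩ : ∃ c, c = (y' - x') / (y - x) := ⟨_, rfl⟩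
  rw [← hcdef] at hc
  let φ : F ↪ F := ⟨fun g => c * g + (x' - c * x),
    fun a b hab => mul_left_cancel₀ hc (add_right_cancel hab)⟩
  have hφ : ∀ g, φ g = c * g + (x' - c * x) := fun _ => rfl
  have hφx : φ x = x' := by rw [hφ, add_sub_cancel]
  have hφy : φ y = y' := by
    have : c * (y - x) = y' - x' := by rw [hcdef, div_mul_cancel₀ _ hyx]
    rw [hφ]
    linear_combination this
  refine card_le_card_of_injOn (fun B => B.map φ) ?_ (map_injective φ).injOn
  intro B hB
  simp only [coe_filter, Set.mem_ofPred_eq] at hB ⊢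
  refine ⟨map_affine_mem_weightEightBlocks hB.1 _ φ hφ, ?_, ?_⟩
  · exact hφx ▸ mem_map_of_mem φ hB.2.1
  · exact hφy ▸ mem_map_of_mem φ hB.2.2

theorem card_mul_card_blocks_through_pair [CharP F 2] (e : ℕ) {x y : F} (h : x ≠ y) :
    (Fintype.card F * Fintype.card F - Fintype.card F) *
      #{B ∈ weightEightBlocks F e | x ∈ B ∧ y ∈ B} = 56 * #(weightEightBlocks F e) := by
  have := sum_card_bipartiteAbove_eq_sum_card_bipartiteBelow
    (s := (univ : Finset F).offDiag) (t := weightEightBlocks F e)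
    (fun p B => p.1 ∈ B ∧ p.2 ∈ B)
  rw [sum_congr rfl (g := fun _ => #{B ∈ weightEightBlocks F e | x ∈ B ∧ y ∈ B}),
    sum_congr rfl (g := fun _ => 56) (s₁ := weightEightBlocks F e), sum_const, sum_const,
    offDiag_card, card_univ, smul_eq_mul, smul_eq_mul] at this
  · rw [this, mul_comm]
  · intro B hB
    have hB' : bipartiteBelow (fun (p : F × F) B => p.1 ∈ B ∧ p.2 ∈ B) univ.offDiag B =
        B.offDiag := by
      ext p
      simp only [mem_bipartiteBelow, mem_offDiag, mem_univ, true_and]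
      tauto
    rw [hB', offDiag_card, (mem_weightEightBlocks.1 hB).1]
  · intro p hp
    have hp : p.1 ≠ p.2 := (mem_offDiag.1 hp).2.2
    exact le_antisymm (card_blocks_through_pair_le e hp h) (card_blocks_through_pair_le e h hp)

end Design

end Field

/-- The 8-element subsets `B` of `F = GF(2^m)` with `∑_{g∈B} g = 0` and
`∑_{g∈B} g^{2^e+1} = 0` form a `2-(2^m, 8, λ)` design with
`λ = (2^m-4)(2^{3m} - 23·2^{2m} + 344·2^m - 1612)/720`. -/
theorem design_weight8 (m : ℕ) (hm6 : 6 ≤ m) (hm4 : m % 4 = 2)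
    (e : ℕ) (he2 : 2 ≤ e) (hem : 2 * e ≤ m) (hgcd : Nat.gcd m e = 2)
    (F : Type) [Field F] [Fintype F] (hF : Fintype.card F = 2 ^ m)
    (x y : F) (hxy : x ≠ y) :
    Nat.card {B : Finset F // B.card = 8 ∧ x ∈ B ∧ y ∈ B ∧
        (∑ g ∈ B, g = 0) ∧ (∑ g ∈ B, g ^ (2 ^ e + 1) = 0)} =
      (2 ^ m - 4) * (2 ^ (3 * m) - 23 * 2 ^ (2 * m) + 344 * 2 ^ m - 1612) / 720 := by
  classical
  have : CharP F 2 := by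
    have : Fact (Nat.Prime 2) := ⟨Nat.prime_two⟩
    exact charP_of_card_eq_prime_pow hF
  have hcard : Nat.card {B : Finset F // B.card = 8 ∧ x ∈ B ∧ y ∈ B ∧
      (∑ g ∈ B, g = 0) ∧ (∑ g ∈ B, g ^ (2 ^ e + 1) = 0)} =
      #{B ∈ weightEightBlocks F e | x ∈ B ∧ y ∈ B} := by
    rw [Nat.card_eq_fintype_card, Fintype.card_subtype]
    congr 1
    ext B
    simp only [mem_filter, mem_univ, true_and, mem_weightEightBlocks]
    tauto
  have hpair := card_mul_card_blocks_through_pair e hxy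
  have htotal := subsetSumCount_goldPoint_eight hm4 hgcd hF
  rw [← card_weightEightBlocks] at htotal
  rw [hcard, pow_mul' 2 3 m, pow_mul' 2 2 m, ← hF]
  have hq : 64 ≤ Fintype.card F := by
    rw [hF]
    exact (show 2 ^ 6 = 64 by norm_num) ▸ Nat.pow_le_pow_right two_pos hm6
  generalize Fintype.card F = q at *
  generalize #{B ∈ weightEightBlocks F e | x ∈ B ∧ y ∈ B} = L at *
  generalize #(weightEightBlocks F e) = A at *
  refine (Nat.div_eq_of_eq_mul_right (by norm_num) ?_).symm
  have h1 : 23 * q ^ 2 ≤ q ^ 3 := by nlinarith [Nat.zero_le (q ^ 2)]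
  have h2 : 1612 ≤ q ^ 3 - 23 * q ^ 2 + 344 * q := by omega
  have h3 : q ≤ q * q := by nlinarith
  have hpair := congrArg (Nat.cast : ℕ → ℚ) hpair
  have hq' : (64 : ℚ) ≤ q := by exact_mod_cast hq
  rw [← Nat.cast_inj (R := ℚ)]
  push_cast [h1, h2, h3, show 4 ≤ q by omega] at hpair ⊢
  have hne : (q : ℚ) * (q - 1) ≠ 0 := by
    apply mul_ne_zero <;> linarith
  apply mul_left_cancel₀ hne
  linear_combination -htotal - 720 * hpair
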